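/- Let ν ∈ ℝ and let Q be an admissible quantization of P of type (i)′ with parameter ν. Then Q(ℓ² sin θ) = Q(sin θ)Q(ℓ)² − i·Q(cos θ)Q(ℓ) + (1/4)Q(sin θ) and Q(ℓ² cos θ) = Q(cos θ)Q(ℓ)² + i·Q(sin θ)Q(ℓ) + (1/4)Q(cos θ) as linear operators on D. -/

import Mathlib

noncomputable section

open Complex

/-- Partial derivative in the first (angle) variable. -/
def pdTheta (f : ℝ × ℝ → ℝ) : ℝ × ℝ → ℝ := fun p => deriv (fun t => f (t, p.2)) p.1

/-- Partial derivative in the second (momentum) variable. -/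
def pdEll (f : ℝ × ℝ → ℝ) : ℝ × ℝ → ℝ := fun p => deriv (fun l => f (p.1, l)) p.2

/-- Poisson bracket `{f,g} = f_ℓ g_θ − f_θ g_ℓ`. -/
def pb (f g : ℝ × ℝ → ℝ) : ℝ × ℝ → ℝ :=
  fun p => pdEll f p * pdTheta g p - pdTheta f p * pdEll g p

/-- Spanning set for the polynomial algebra `P`. -/
def PGens : Set (ℝ × ℝ → ℝ) :=
  {h | ∃ r m : ℕ, h = (fun p : ℝ × ℝ => p.2 ^ r * Real.sin (m * p.1)) ∨
       h = (fun p : ℝ × ℝ => p.2 ^ r * Real.cos (m * p.1))}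

/-- The polynomial algebra `P`. -/
def P : Submodule ℝ (ℝ × ℝ → ℝ) := Submodule.span ℝ PGens

def fone : ℝ × ℝ → ℝ := fun _ => 1
def fell : ℝ × ℝ → ℝ := fun p => p.2
def fsin : ℝ × ℝ → ℝ := fun p => Real.sin p.1
def fcos : ℝ × ℝ → ℝ := fun p => Real.cos p.1

lemma fone_mem_P : fone ∈ P :=
  Submodule.subset_span ⟨0, 0, Or.inr (by funext p; simp [fone])⟩

lemma fell_mem_P : fell ∈ P :=
  Submodule.subset_span ⟨1, 0, Or.inr (by funext p; simp [fell])⟩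

lemma fsin_mem_P : fsin ∈ P :=
  Submodule.subset_span ⟨0, 1, Or.inl (by funext p; simp [fsin])⟩

lemma fcos_mem_P : fcos ∈ P :=
  Submodule.subset_span ⟨0, 1, Or.inr (by funext p; simp [fcos])⟩

/-- The domain `D = C^∞(S¹,ℂ)`: smooth `2π`-periodic functions. -/
def Dom : Submodule ℂ (ℝ → ℂ) where
  carrier := {ψ | ContDiff ℝ (⊤ : ℕ∞) ψ ∧ ∀ t, ψ (t + 2 * Real.pi) = ψ t}
  add_mem' := by
    intro a b ha hb
    exact ⟨ha.1.add hb.1, fun t => by simp [Pi.add_apply, ha.2 t, hb.2 t]⟩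
  zero_mem' := ⟨contDiff_const, fun t => rfl⟩
  smul_mem' := by
    intro c a ha
    exact ⟨ha.1.const_smul c, fun t => by simp [Pi.smul_apply, ha.2 t]⟩

/-- The `L²` inner product on `D`. -/
def ip (φ ψ : ℝ → ℂ) : ℂ := ∫ t in (0:ℝ)..(2 * Real.pi), (starRingEnd ℂ) (φ t) * ψ t

/-- Symmetric operator on `D`. -/
def SymmetricOp (A : Dom →ₗ[ℂ] Dom) : Prop :=
  ∀ φ ψ : Dom, ip (A φ : ℝ → ℂ) (ψ : ℝ → ℂ) = ip (φ : ℝ → ℂ) (A ψ : ℝ → ℂ)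

/-- An admissible quantization of type (i)′ with parameter ν of a Lie subalgebra
`O ⊆ P` containing the basic set. -/
structure IsQuant (O : Submodule ℝ (ℝ × ℝ → ℝ)) (ν : ℝ)
    (Q : O →ₗ[ℝ] (Dom →ₗ[ℂ] Dom)) : Prop where
  map_bracket : ∀ (f g : O) (h : pb f g ∈ O),
    Q ⟨pb f g, h⟩ = Complex.I • (Q f ∘ₗ Q g - Q g ∘ₗ Q f)
  map_one : ∀ h : fone ∈ O, Q ⟨fone, h⟩ = LinearMap.id
  symm : ∀ f : O, SymmetricOp (Q f)
  map_ell : ∀ (h : fell ∈ O) (ψ : Dom) (t : ℝ),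
    (Q ⟨fell, h⟩ ψ : ℝ → ℂ) t = -Complex.I * deriv (ψ : ℝ → ℂ) t + (ν : ℂ) * (ψ : ℝ → ℂ) t
  map_sin : ∀ (h : fsin ∈ O) (ψ : Dom) (t : ℝ),
    (Q ⟨fsin, h⟩ ψ : ℝ → ℂ) t = (Real.sin t : ℂ) * (ψ : ℝ → ℂ) t
  map_cos : ∀ (h : fcos ∈ O) (ψ : Dom) (t : ℝ),
    (Q ⟨fcos, h⟩ ψ : ℝ → ℂ) t = (Real.cos t : ℂ) * (ψ : ℝ → ℂ) t

end
noncomputable section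
/-- `ℓ² sin θ` -/
def fell2sin : ℝ × ℝ → ℝ := fun p => p.2 ^ 2 * Real.sin p.1
/-- `ℓ² cos θ` -/
def fell2cos : ℝ × ℝ → ℝ := fun p => p.2 ^ 2 * Real.cos p.1

lemma fell2sin_mem_P : fell2sin ∈ P :=
  Submodule.subset_span ⟨2, 1, Or.inl (by funext p; simp [fell2sin])⟩
lemma fell2cos_mem_P : fell2cos ∈ P :=
  Submodule.subset_span ⟨2, 1, Or.inr (by funext p; simp [fell2cos])⟩

section aux
open Complex
lemma abs_alg {M : Type*} [AddCommGroup M] [Module ℂ M] (e : ℤ → M) (he : ∀ k, e k ≠ 0)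
    (ν : ℂ) (c : ℤ → ℂ) (L S C q As Ac Xs Xc : M →ₗ[ℂ] M)
    (hL : ∀ k, L (e k) = ((k:ℂ) + ν) • e k)
    (hS : ∀ k, S (e k) = (-I/2) • e (k+1) + (I/2) • e (k-1))
    (hC : ∀ k, C (e k) = (1/2:ℂ) • e (k+1) + (1/2:ℂ) • e (k-1))
    (hq : ∀ k, q (e k) = c k • e k)
    (h1 : (2:ℂ) • Ac = I • (q ∘ₗ S - S ∘ₗ q))
    (h2 : (-2:ℂ) • As = I • (q ∘ₗ C - C ∘ₗ q))
    (h3 : (2:ℂ) • Xc = I • (q ∘ₗ As - As ∘ₗ q))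
    (h4 : (-2:ℂ) • Xs = I • (q ∘ₗ Ac - Ac ∘ₗ q))
    (h5 : -L = I • (As ∘ₗ Ac - Ac ∘ₗ As))
    (h6 : LinearMap.id = I • (Ac ∘ₗ S - S ∘ₗ Ac) - I • (As ∘ₗ C - C ∘ₗ As)) :
    (∀ k, Xs (e k) = (S ∘ₗ L ∘ₗ L - I • (C ∘ₗ L) + (1/4:ℂ) • S) (e k)) ∧
    (∀ k, Xc (e k) = (C ∘ₗ L ∘ₗ L + I • (S ∘ₗ L) + (1/4:ℂ) • C) (e k)) := by
  have hI : I * I = -1 := I_mul_I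
  obtain ⟨d, hd⟩ : ∃ d : ℤ → ℂ, ∀ k, c (k+1) = c k + 2 * d k :=
    ⟨fun k => (c (k+1) - c k)/2, fun k => by ring⟩
  have hd' : ∀ k, c (k-1) = c k - 2 * d (k-1) := fun k => by
    have := hd (k-1); rw [sub_add_cancel] at this; rw [this]; ring
  have hAc : ∀ k, Ac (e k) = (d k/2) • e (k+1) + (d (k-1)/2) • e (k-1) := by
    intro k
    have := congrArg (fun T => (1/2:ℂ) • T (e k)) h1
    simp [hS, hq, hd, hd', smul_smul] at this
    rw [this]
    match_scalars <;> grind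
  have hAs : ∀ k, As (e k) = (-I*d k/2) • e (k+1) + (I*d (k-1)/2) • e (k-1) := by
    intro k
    have := congrArg (fun T => (-1/2:ℂ) • T (e k)) h2
    simp [hC, hq, hd, hd', smul_smul] at this
    norm_num at this
    rw [this]
    match_scalars <;> grind
  have hXc : ∀ k, Xc (e k) = (d k ^ 2/2) • e (k+1) + (d (k-1) ^ 2/2) • e (k-1) := by
    intro k
    have := congrArg (fun T => (1/2:ℂ) • T (e k)) h3
    simp [hAs, hq, hd, hd', smul_smul] at this
    rw [this]
    match_scalars <;> grind
  have hXs : ∀ k, Xs (e k) = (-I*d k ^ 2/2) • e (k+1) + (I*d (k-1) ^ 2/2) • e (k-1) := by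
    intro k
    have := congrArg (fun T => (-1/2:ℂ) • T (e k)) h4
    simp [hAc, hq, hd, hd', smul_smul] at this
    norm_num at this
    rw [this]
    match_scalars <;> grind
  have e1 : ∀ k, d (k-1) = d k - 1 := by
    intro k
    have := congrArg (fun T => T (e k)) h6
    simp [hAc, hAs, hS, hC, smul_smul] at this
    rw [← sub_eq_zero] at this
    have h : (d (k-1) - (d k - 1)) • e k = 0 := by
      rw [← this]
      match_scalars <;> grind
    exact sub_eq_zero.1 ((smul_eq_zero.1 h).resolve_right (he k))
  have e2 : ∀ k, d k ^ 2 - d (k-1) ^ 2 = 2 * (k + ν) := by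
    intro k
    have := congrArg (fun T => (2:ℂ) • T (e k)) h5
    simp [hAc, hAs, hL, smul_smul] at this
    rw [← sub_eq_zero] at this
    have h : (d k ^ 2 - d (k-1) ^ 2 - 2 * (k + ν)) • e k = 0 := by
      rw [← this]
      match_scalars <;> grind
    exact sub_eq_zero.1 ((smul_eq_zero.1 h).resolve_right (he k))
  have e3 : ∀ k, d k = k + ν + 1/2 := by
    intro k
    have := e2 k
    rw [e1] at this
    linear_combination this / 2
  constructor
  · intro k
    simp [hXs, hL, hS, hC, e1, e3, smul_smul]
    match_scalars <;> grind
  · intro k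
    simp [hXc, hL, hS, hC, e1, e3, smul_smul]
    match_scalars <;> grind

lemma dom_diff (φ : Dom) : Differentiable ℝ (φ : ℝ → ℂ) :=
  φ.2.1.differentiable (by simp)

lemma dom_cont (φ : Dom) : Continuous (φ : ℝ → ℂ) := φ.2.1.continuous

def ee (k : ℤ) : Dom := ⟨fun t => Complex.exp (I * k * t), by
  refine ⟨?_, ?_⟩
  · have h : ContDiff ℝ (⊤ : ℕ∞) (fun t : ℝ => I * k * (t:ℂ)) :=
      contDiff_const.mul Complex.ofRealCLM.contDiff
    exact h.cexp
  · intro t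
    rw [Complex.exp_eq_exp_iff_exists_int]
    exact ⟨k, by push_cast; ring⟩⟩

lemma ee_apply (k : ℤ) (t : ℝ) : (ee k : ℝ → ℂ) t = Complex.exp (I * k * t) := rfl

lemma ee_deriv (k : ℤ) (t : ℝ) :
    HasDerivAt (ee k : ℝ → ℂ) (I * k * Complex.exp (I * k * t)) t := by
  have h : HasDerivAt (fun t : ℝ => I * k * (t:ℂ)) (I * k) t := by
    simpa using (Complex.ofRealCLM.hasDerivAt (x := t)).const_mul (I * (k:ℂ))
  have := h.cexp
  rw [mul_comm (Complex.exp _)] at this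
  exact this

lemma ee_ne (k : ℤ) : ee k ≠ 0 := by
  intro h
  have := congrArg (fun φ : Dom => (φ : ℝ → ℂ) 0) h
  simp [ee_apply] at this

lemma ee_add (k : ℤ) (t : ℝ) :
    (ee (k+1) : ℝ → ℂ) t = (Complex.cos t + Complex.sin t * I) * (ee k : ℝ → ℂ) t := by
  rw [ee_apply, ee_apply, ← Complex.exp_mul_I, ← Complex.exp_add]
  congr 1; push_cast; ring

lemma ee_sub (k : ℤ) (t : ℝ) :
    (ee (k-1) : ℝ → ℂ) t = (Complex.cos t - Complex.sin t * I) * (ee k : ℝ → ℂ) t := by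
  have : Complex.cos t - Complex.sin t * I = Complex.exp (-t * I) := by
    rw [Complex.exp_mul_I]; simp; ring
  rw [ee_apply, ee_apply, this, ← Complex.exp_add]
  congr 1; push_cast; ring

lemma eig (k : ℤ) (φ : Dom) (h : ∀ t, -I * deriv (φ : ℝ → ℂ) t = k * (φ : ℝ → ℂ) t) :
    ∃ c : ℂ, φ = c • ee k := by
  have hder : ∀ t, HasDerivAt (fun t => (φ : ℝ → ℂ) t * (ee (-k) : ℝ → ℂ) t) 0 t := by
    intro t
    have h1 := ((dom_diff φ) t).hasDerivAt.mul (ee_deriv (-k) t)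
    refine h1.congr_deriv ?_
    have h2 : deriv (φ : ℝ → ℂ) t = I * (k * (φ : ℝ → ℂ) t) := by
      rw [← h t, ← mul_assoc]; simp
    rw [h2, ee_apply]; push_cast; ring
  have hc : ∀ t, (φ : ℝ → ℂ) t * (ee (-k) : ℝ → ℂ) t = (φ : ℝ → ℂ) 0 * (ee (-k) : ℝ → ℂ) 0 :=
    fun t => is_const_of_deriv_eq_zero (fun t => (hder t).differentiableAt)
      (fun t => (hder t).deriv) t 0
  refine ⟨(φ : ℝ → ℂ) 0, ?_⟩
  ext t
  have h3 := hc t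
  have h4 : Complex.exp (I * ((-k : ℤ):ℂ) * t) * Complex.exp (I * k * t) = 1 := by
    rw [← Complex.exp_add]; simp
  simp only [ee_apply] at h3
  have h5 : (φ : ℝ → ℂ) t * (Complex.exp (I * ((-k : ℤ):ℂ) * t) * Complex.exp (I * k * t))
    = (φ : ℝ → ℂ) 0 * Complex.exp (I * k * t) := by
    rw [← mul_assoc, h3]; simp
  rw [h4, mul_one] at h5
  simpa [ee_apply] using h5

lemma fourier_unique (φ : Dom) (h : ∀ k, ip (ee k) φ = 0) : φ = 0 := by
  have : Fact (0 < 2 * Real.pi) := ⟨Real.two_pi_pos⟩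
  have hp : Function.Periodic (φ : ℝ → ℂ) (2 * Real.pi) := φ.2.2
  let f : C(AddCircle (2 * Real.pi), ℂ) := ⟨hp.lift, continuous_coinduced_dom.mpr (dom_cont φ)⟩
  have hf : ∀ t : ℝ, f (t : AddCircle (2 * Real.pi)) = (φ : ℝ → ℂ) t := fun t => rfl
  have h0 : ∀ n, fourierCoeff f n = 0 := by
    intro n
    rw [fourierCoeff_eq_intervalIntegral f n 0]
    have : ∫ x in (0:ℝ)..0 + 2 * Real.pi, fourier (-n) (x : AddCircle (2 * Real.pi)) • f x
        = ip (ee n) φ := by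
      rw [ip, zero_add]
      congr 1
      ext t
      rw [hf, fourier_coe_apply, ee_apply, ← Complex.exp_conj, smul_eq_mul]
      congr 2
      have : (Real.pi : ℂ) ≠ 0 := by exact_mod_cast Real.pi_ne_zero
      simp
      field_simp
    rw [this, h, smul_zero]
  have hs : Summable (fourierCoeff f) := by
    have : fourierCoeff f = fun _ => 0 := funext h0
    rw [this]; exact summable_zero
  ext t
  have h1 := has_pointwise_sum_fourier_series_of_summable hs (t : AddCircle (2 * Real.pi))
  simp only [h0, zero_smul] at h1
  rw [← hf]
  exact h1.unique hasSum_zero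

lemma ip_intg (φ ψ : Dom) : IntervalIntegrable
    (fun t => (starRingEnd ℂ) ((φ : ℝ → ℂ) t) * (ψ : ℝ → ℂ) t) MeasureTheory.volume 0 (2 * Real.pi) :=
  ((Complex.continuous_conj.comp (dom_cont φ)).mul (dom_cont ψ)).intervalIntegrable _ _

lemma ip_add_left (a b c : Dom) : ip ((a + b : Dom)) c = ip a c + ip b c := by
  rw [ip, ip, ip, ← intervalIntegral.integral_add (ip_intg a c) (ip_intg b c)]
  congr 1; ext t; simp; ring

lemma ip_add_right (a b c : Dom) : ip c ((a + b : Dom)) = ip c a + ip c b := by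
  rw [ip, ip, ip, ← intervalIntegral.integral_add (ip_intg c a) (ip_intg c b)]
  congr 1; ext t; simp; ring

lemma ip_smul_left (r : ℝ) (a c : Dom) : ip (((r:ℂ) • a : Dom)) c = r * ip a c := by
  rw [ip, ip, ← intervalIntegral.integral_const_mul]
  congr 1; ext t; simp; ring

lemma ip_smul_right (r : ℝ) (a c : Dom) : ip c (((r:ℂ) • a : Dom)) = r * ip c a := by
  rw [ip, ip, ← intervalIntegral.integral_const_mul]
  congr 1; ext t; simp; ring

lemma op_unique (A B : Dom →ₗ[ℂ] Dom) (hA : SymmetricOp A) (hB : SymmetricOp B)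
    (h : ∀ k, A (ee k) = B (ee k)) : A = B := by
  ext1 ψ
  rw [← sub_eq_zero]
  apply fourier_unique
  intro k
  have h1 : ip (ee k) (A ψ) = ip (ee k) (B ψ) := by
    rw [← hA, ← hB, h]
  have h2 : A ψ - B ψ = A ψ + (((-1 : ℝ)):ℂ) • B ψ := by push_cast; module
  rw [h2, ip_add_right, ip_smul_right, h1]
  push_cast; ring

lemma symm_B (L S : Dom →ₗ[ℂ] Dom) (hL : SymmetricOp L) (hS : SymmetricOp S) :
    SymmetricOp (L ∘ₗ S ∘ₗ L + (1/4:ℂ) • S) := by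
  intro φ ψ
  have : (1/4:ℂ) = ((1/4:ℝ):ℂ) := by push_cast; rfl
  rw [this]
  simp only [LinearMap.add_apply, LinearMap.comp_apply, LinearMap.smul_apply]
  rw [ip_add_left, ip_add_right, ip_smul_left, ip_smul_right, hL, hS, hL, hS]

lemma memS (r m : ℕ) : (fun p : ℝ × ℝ => p.2 ^ r * Real.sin (m * p.1)) ∈ P :=
  Submodule.subset_span ⟨r, m, Or.inl rfl⟩
lemma memC (r m : ℕ) : (fun p : ℝ × ℝ => p.2 ^ r * Real.cos (m * p.1)) ∈ P :=
  Submodule.subset_span ⟨r, m, Or.inr rfl⟩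

def fq : ℝ × ℝ → ℝ := fun p => p.2 ^ 2
def fls : ℝ × ℝ → ℝ := fun p => p.2 * Real.sin p.1
def flc : ℝ × ℝ → ℝ := fun p => p.2 * Real.cos p.1
def fss : ℝ × ℝ → ℝ := fun p => Real.sin p.1 ^ 2
def fcc : ℝ × ℝ → ℝ := fun p => Real.cos p.1 ^ 2
lemma fq_mem : fq ∈ P := by
  have h := memC 2 0
  simp at h
  exact h
lemma fls_mem : fls ∈ P := by
  have h := memS 1 1
  simp at h
  exact h
lemma flc_mem : flc ∈ P := by
  have h := memC 1 1
  simp at h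
  exact h
lemma fcc_mem : fcc ∈ P := by
  have : fcc = (1/2:ℝ) • fone + (1/2:ℝ) • (fun p : ℝ × ℝ => p.2 ^ 0 * Real.cos ((2:ℕ) * p.1)) := by
    funext p
    simp [fcc, fone, Real.cos_two_mul]; ring
  rw [this]
  exact P.add_mem (P.smul_mem _ fone_mem_P) (P.smul_mem _ (memC 0 2))
lemma fss_mem : fss ∈ P := by
  have : fss = fone - fcc := by
    funext p
    simp [fcc, fone, fss, Real.sin_sq]
  rw [this]
  exact P.sub_mem fone_mem_P fcc_mem

lemma pb0 : pb fell fq = 0 := by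
  funext p; simp [pb, pdEll, pdTheta, fell, fq]
lemma pb1 : pb fq fsin = (2:ℝ) • flc := by
  funext p; simp [pb, pdEll, pdTheta, fq, fsin, flc]; ring
lemma pb2 : pb fq fcos = (-2:ℝ) • fls := by
  funext p; simp [pb, pdEll, pdTheta, fq, fcos, fls]; ring
lemma pb3 : pb fq fls = (2:ℝ) • fell2cos := by
  funext p; simp [pb, pdEll, pdTheta, fq, fls, fell2cos]; ring
lemma pb4 : pb fq flc = (-2:ℝ) • fell2sin := by
  funext p; simp [pb, pdEll, pdTheta, fq, flc, fell2sin]; ring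
lemma pb5 : pb fls flc = -fell := by
  funext p; simp [pb, pdEll, pdTheta, fls, flc, fell]
  linear_combination (-p.2) * Real.sin_sq_add_cos_sq p.1
lemma pb6 : pb flc fsin = fcc := by
  funext p; simp [pb, pdEll, pdTheta, flc, fsin, fcc]; ring
lemma pb7 : pb fls fcos = -fss := by
  funext p; simp [pb, pdEll, pdTheta, fls, fcos, fss]; ring
lemma pb8 : pb fell fsin = fcos := by
  funext p; simp [pb, pdEll, pdTheta, fell, fsin, fcos]
lemma pb9 : pb fell fcos = -fsin := by
  funext p; simp [pb, pdEll, pdTheta, fell, fsin, fcos]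

end aux

theorem stmt2 (ν : ℝ) (Q : P →ₗ[ℝ] (Dom →ₗ[ℂ] Dom)) (hQ : IsQuant P ν Q) :
    Q ⟨fell2sin, fell2sin_mem_P⟩ =
        Q ⟨fsin, fsin_mem_P⟩ ∘ₗ Q ⟨fell, fell_mem_P⟩ ∘ₗ Q ⟨fell, fell_mem_P⟩ -
          Complex.I • (Q ⟨fcos, fcos_mem_P⟩ ∘ₗ Q ⟨fell, fell_mem_P⟩) +
          (1 / 4 : ℂ) • Q ⟨fsin, fsin_mem_P⟩ ∧
      Q ⟨fell2cos, fell2cos_mem_P⟩ =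
        Q ⟨fcos, fcos_mem_P⟩ ∘ₗ Q ⟨fell, fell_mem_P⟩ ∘ₗ Q ⟨fell, fell_mem_P⟩ +
          Complex.I • (Q ⟨fsin, fsin_mem_P⟩ ∘ₗ Q ⟨fell, fell_mem_P⟩) +
          (1 / 4 : ℂ) • Q ⟨fcos, fcos_mem_P⟩ := by
  have br : ∀ (f g h : P), pb f g = (h : ℝ × ℝ → ℝ) →
      Q h = Complex.I • (Q f ∘ₗ Q g - Q g ∘ₗ Q f) := by
    intro f g h e
    have h' : pb f g ∈ P := by rw [e]; exact h.2
    rw [← hQ.map_bracket f g h']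
    congr 1
    exact Subtype.ext e.symm
  have hsm : ∀ (r : ℝ) (f : P), Q (r • f) = (r:ℂ) • Q f := by
    intro r f; rw [map_smul]; rfl
  have g0 := br ⟨fell, fell_mem_P⟩ ⟨fq, fq_mem⟩ 0 pb0
  have g1 := br ⟨fq, fq_mem⟩ ⟨fsin, fsin_mem_P⟩ ((2:ℝ) • ⟨flc, flc_mem⟩) pb1
  have g2 := br ⟨fq, fq_mem⟩ ⟨fcos, fcos_mem_P⟩ ((-2:ℝ) • ⟨fls, fls_mem⟩) pb2
  have g3 := br ⟨fq, fq_mem⟩ ⟨fls, fls_mem⟩ ((2:ℝ) • ⟨fell2cos, fell2cos_mem_P⟩) pb3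
  have g4 := br ⟨fq, fq_mem⟩ ⟨flc, flc_mem⟩ ((-2:ℝ) • ⟨fell2sin, fell2sin_mem_P⟩) pb4
  have g5 := br ⟨fls, fls_mem⟩ ⟨flc, flc_mem⟩ (-⟨fell, fell_mem_P⟩) pb5
  have g6 := br ⟨flc, flc_mem⟩ ⟨fsin, fsin_mem_P⟩ ⟨fcc, fcc_mem⟩ pb6
  have g7 := br ⟨fls, fls_mem⟩ ⟨fcos, fcos_mem_P⟩ (-⟨fss, fss_mem⟩) pb7
  have g8 := br ⟨fell, fell_mem_P⟩ ⟨fsin, fsin_mem_P⟩ ⟨fcos, fcos_mem_P⟩ pb8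
  have g9 := br ⟨fell, fell_mem_P⟩ ⟨fcos, fcos_mem_P⟩ (-⟨fsin, fsin_mem_P⟩) pb9
  have h6 : (LinearMap.id : Dom →ₗ[ℂ] Dom) = Q ⟨fcc, fcc_mem⟩ - Q (-⟨fss, fss_mem⟩) := by
    have e1 : Q ⟨fcc, fcc_mem⟩ = Q ⟨fone, fone_mem_P⟩ + Q (-⟨fss, fss_mem⟩) := by
      refine Eq.trans ?_ (LinearMap.map_add Q _ _)
      congr 1
      apply Subtype.ext
      funext p
      simp [fone, fcc, fss, Real.cos_sq', sub_eq_add_neg]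
    rw [e1, hQ.map_one fone_mem_P]
    apply LinearMap.ext
    intro x
    simp only [LinearMap.sub_apply, LinearMap.add_apply]
    abel
  rw [g6, g7] at h6
  rw [hsm] at g1 g2 g3 g4
  rw [map_neg] at g5 g9
  rw [map_zero] at g0
  have hL := hQ.map_ell fell_mem_P
  have hS := hQ.map_sin fsin_mem_P
  have hC := hQ.map_cos fcos_mem_P
  have sL := hQ.symm ⟨fell, fell_mem_P⟩
  have sS := hQ.symm ⟨fsin, fsin_mem_P⟩
  have sC := hQ.symm ⟨fcos, fcos_mem_P⟩
  have sXs := hQ.symm ⟨fell2sin, fell2sin_mem_P⟩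
  have sXc := hQ.symm ⟨fell2cos, fell2cos_mem_P⟩
  generalize Q ⟨fell, fell_mem_P⟩ = L at *
  generalize Q ⟨fsin, fsin_mem_P⟩ = S at *
  generalize Q ⟨fcos, fcos_mem_P⟩ = C at *
  generalize Q ⟨fls, fls_mem⟩ = As at *
  generalize Q ⟨flc, flc_mem⟩ = Ac at *
  generalize Q ⟨fell2sin, fell2sin_mem_P⟩ = Xs at *
  generalize Q ⟨fell2cos, fell2cos_mem_P⟩ = Xc at *
  generalize Q ⟨fq, fq_mem⟩ = q at *
  have hLe : ∀ k, L (ee k) = ((k:ℂ) + ν) • ee k := by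
    intro k
    ext t
    rw [hL, (ee_deriv k t).deriv]
    simp only [SetLike.val_smul, Pi.smul_apply, smul_eq_mul, ee_apply]
    linear_combination (-(k:ℂ) * Complex.exp (Complex.I * k * t)) * Complex.I_mul_I
  have hSe : ∀ k, S (ee k) = (-Complex.I/2) • ee (k+1) + (Complex.I/2) • ee (k-1) := by
    intro k
    ext t
    rw [hS]
    simp only [Submodule.coe_add, Pi.add_apply, SetLike.val_smul, Pi.smul_apply, smul_eq_mul,
      ee_add, ee_sub, Complex.ofReal_sin]
    linear_combination (Complex.sin t * (ee k : ℝ → ℂ) t) * Complex.I_mul_I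
  have hCe : ∀ k, C (ee k) = (1/2:ℂ) • ee (k+1) + (1/2:ℂ) • ee (k-1) := by
    intro k
    ext t
    rw [hC]
    simp only [Submodule.coe_add, Pi.add_apply, SetLike.val_smul, Pi.smul_apply, smul_eq_mul,
      ee_add, ee_sub, Complex.ofReal_cos]
    ring
  have hqe : ∀ k, ∃ c : ℂ, q (ee k) = c • ee k := by
    intro k
    apply eig
    intro t
    have h0 : L (q (ee k)) = q (L (ee k)) := by
      have := congrArg (fun T => T (ee k)) g0
      simp at this
      exact sub_eq_zero.1 ((smul_eq_zero.1 this.symm).resolve_left Complex.I_ne_zero)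
    rw [hLe, map_smul] at h0
    have := congrArg (fun φ : Dom => (φ : ℝ → ℂ) t) h0
    simp only [SetLike.val_smul, Pi.smul_apply, smul_eq_mul] at this
    rw [hL] at this
    linear_combination this
  choose c hc using hqe
  obtain ⟨r1, r2⟩ := abs_alg ee ee_ne ν c L S C q As Ac Xs Xc hLe hSe hCe hc
    (by simpa using g1) (by simpa using g2) (by simpa using g3) (by simpa using g4) g5 h6
  have k1 : L ∘ₗ S = S ∘ₗ L - Complex.I • C := by
    rw [g8, smul_smul, Complex.I_mul_I]; module
  have k2 : L ∘ₗ C = C ∘ₗ L + Complex.I • S := by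
    rw [← neg_neg S, g9, smul_neg, smul_smul, Complex.I_mul_I]; module
  have b1 : S ∘ₗ L ∘ₗ L - Complex.I • (C ∘ₗ L) + (1/4:ℂ) • S = L ∘ₗ S ∘ₗ L + (1/4:ℂ) • S := by
    rw [← LinearMap.comp_assoc L S L, k1]; rfl
  have b2 : C ∘ₗ L ∘ₗ L + Complex.I • (S ∘ₗ L) + (1/4:ℂ) • C = L ∘ₗ C ∘ₗ L + (1/4:ℂ) • C := by
    rw [← LinearMap.comp_assoc L C L, k2]; rfl
  constructor
  · exact op_unique _ _ sXs (b1 ▸ symm_B L S sL sS) r1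
  · exact op_unique _ _ sXc (b2 ▸ symm_B L C sL sC) r2
end
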